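/- arXiv:2102.08670 — 7 statements merged into one kernel-verified Lean document; each statement's English description precedes it below -/
import Mathlib

section
/- For every position i ∈ [1,n] of a length-n string S, the longest Lyndon word starting at position i is exactly the substring S[i..nss(i)); equivalently, λ[i] = nss(i) − i for all i ∈ [1,n]. -/
open List

variable {α : Type*} [LinearOrder α]

/-- The substring `S[i..j]` (1-based, both endpoints inclusive). -/
def sub (S : ℕ → α) (i j : ℕ) : List α := (List.range' i (j + 1 - i)).map S

/-- The suffix `S_i = S[i..n]` (empty for `i = n + 1`). -/
def suf (S : ℕ → α) (n i : ℕ) : List α := sub S i n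

/-- The prefix `S[1..i]`. -/
def pre (S : ℕ → α) (i : ℕ) : List α := sub S 1 i

/-- Strict lexicographic order `≺` on strings. -/
def slt (l₁ l₂ : List α) : Prop := List.Lex (· < ·) l₁ l₂

/-- Length of the longest common prefix of two lists. -/
def lcpLen (l₁ l₂ : List α) : ℕ :=
  Nat.findGreatest (fun k => l₁.take k = l₂.take k) (min l₁.length l₂.length)

/-- `rlce S n i j` : length of the longest common prefix of suffixes `S_i` and `S_j`. -/
def rlce (S : ℕ → α) (n i j : ℕ) : ℕ := lcpLen (suf S n i) (suf S n j)

/-- `llce S i j` : length of the longest common suffix of prefixes `S[1..i]` and `S[1..j]`. -/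
def llce (S : ℕ → α) (i j : ℕ) : ℕ := lcpLen (pre S i).reverse (pre S j).reverse

/-- Next-smaller-suffix array: `nss S n i = min { j | j = n+1 ∨ (i < j ≤ n ∧ S_j ≺ S_i) }`. -/
noncomputable def nss (S : ℕ → α) (n i : ℕ) : ℕ :=
  sInf {j | j = n + 1 ∨ (i < j ∧ j ≤ n ∧ slt (suf S n j) (suf S n i))}

/-- A Lyndon word: nonempty and strictly smaller than each of its non-trivial cyclic shifts. -/
def IsLyndon (l : List α) : Prop :=
  l ≠ [] ∧ ∀ k, 0 < k → k < l.length → slt l (l.drop k ++ l.take k)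

/-- The Lyndon array: `lyn S n i = max { j - i + 1 | i ≤ j ≤ n, S[i..j] is a Lyndon word }`. -/
noncomputable def lyn (S : ℕ → α) (n i : ℕ) : ℕ :=
  sSup {m | ∃ j, i ≤ j ∧ j ≤ n ∧ IsLyndon (sub S i j) ∧ m = j - i + 1}

/-- `p ≥ 1` is a period of `S[i..j]`: `S[x] = S[x+p]` for all `x ∈ [i, j - p]`. -/
def IsPeriod (S : ℕ → α) (i j p : ℕ) : Prop :=
  1 ≤ p ∧ ∀ x, i ≤ x → x + p ≤ j → S x = S (x + p)

/-- A run `(i,j,p)` in a string of length `n`. -/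
def IsRun (S : ℕ → α) (n i j p : ℕ) : Prop :=
  1 ≤ i ∧ i ≤ j ∧ j ≤ n ∧
  IsPeriod S i j p ∧ (∀ q, 1 ≤ q → q < p → ¬ IsPeriod S i j q) ∧
  2 * p ≤ j - i + 1 ∧
  (1 < i → ¬ IsPeriod S (i - 1) j p) ∧
  (j < n → ¬ IsPeriod S i (j + 1) p)

/-- A (lexicographically) decreasing run: a run with `S_i ≻ S_{i+p}`. -/
def IsDecRun (S : ℕ → α) (n i j p : ℕ) : Prop :=
  IsRun S n i j p ∧ slt (suf S n (i + p)) (suf S n i)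

theorem append_lt_append_left_iff (l a b : List α) : l ++ a < l ++ b ↔ a < b := by
  induction l with
  | nil => simp
  | cons x l ih => simp [ih]

theorem append_lt_append_of_lt_of_length_eq {a b : List α} (c d : List α)
    (hl : a.length = b.length) (h : a < b) : a ++ c < b ++ d := by
  induction a generalizing b with
  | nil =>
    cases b with
    | nil => exact absurd h (lt_irrefl _)
    | cons y b => simp at hl
  | cons x a ih =>
    cases b with
    | nil => simp at hl
    | cons y b =>
      simp only [List.cons_append, List.cons_lt_cons_iff] at h ⊢
      rcases h with h | ⟨rfl, h⟩
      · exact Or.inl h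
      · exact Or.inr ⟨rfl, ih (by simpa using hl) h⟩

theorem le_of_append_lt_append {a b c d : List α} (hl : a.length = b.length)
    (h : a ++ c < b ++ d) : a ≤ b :=
  not_lt.1 fun hba => lt_asymm h (append_lt_append_of_lt_of_length_eq d c hl.symm hba)

theorem not_lt_append_of_append_comm (v : List α) (N : ℕ) (a b : List α)
    (hN : a.length + b.length ≤ N) (hab : a ++ b = b ++ a) (ha : a ++ v < v) :
    ¬ v < b ++ v := by
  induction N generalizing a b with
  | zero =>
    have : a = [] := List.length_eq_zero_iff.1 (by omega)
    simp [this] at ha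
  | succ N ih =>
    intro hb
    have ha0 : 0 < a.length :=
      List.length_pos_iff.2 (by rintro rfl; exact absurd ha (lt_irrefl _))
    have hb0 : 0 < b.length :=
      List.length_pos_iff.2 (by rintro rfl; exact absurd hb (lt_irrefl _))
    rcases le_total a.length b.length with hl | hl
    · obtain ⟨c, rfl⟩ := List.prefix_of_prefix_length_le
        (hab ▸ List.prefix_append a b) (List.prefix_append b a) hl
      have hac : a ++ c = c ++ a := by simpa using hab
      refine ih a c (by simp at hN; omega) hac ha (hb.trans ?_)
      rw [hac, List.append_assoc, append_lt_append_left_iff]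
      exact ha
    · obtain ⟨c, rfl⟩ := List.prefix_of_prefix_length_le
        (List.prefix_append b a) (hab ▸ List.prefix_append a b) hl
      have hbc : b ++ c = c ++ b := by simpa using hab.symm
      refine ih c b (by simp at hN; omega) hbc.symm (lt_trans ?_ ha) hb
      rw [hbc, List.append_assoc, append_lt_append_left_iff]
      exact hb

theorem isLyndon_of_lt_suffixes {u v : List α} (hu : u ≠ [])
    (hsuf : ∀ k, 0 < k → k < u.length → u ++ v < u.drop k ++ v) (hv : v < u ++ v) :
    IsLyndon u := by
  refine ⟨hu, fun k hk hku => ?_⟩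
  have h := hsuf k hk hku
  change u < u.drop k ++ u.take k
  have hu' : u.take k ++ u.drop k = u := List.take_append_drop k u
  generalize u.take k = a at *
  generalize u.drop k = b at *
  subst hu'
  have hlt : (a ++ b) ++ v < (b ++ a) ++ (b ++ v) := by
    refine h.trans ?_
    simpa [append_lt_append_left_iff] using hv
  refine lt_of_le_of_ne (le_of_append_lt_append (by simp [add_comm]) hlt) fun hab => ?_
  refine not_lt_append_of_append_comm v _ a b le_rfl hab ?_ (hv.trans h)
  rwa [hab, List.append_assoc, append_lt_append_left_iff] at h

theorem not_isLyndon_append {u x v : List α} (hu : u ≠ []) (hx : x ≠ [])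
    (hv : x ++ v < (u ++ x) ++ v) : ¬ IsLyndon (u ++ x) := by
  rintro ⟨-, h⟩
  have hu0 := List.length_pos_iff.2 hu
  have hx0 := List.length_pos_iff.2 hx
  have h₁ : u ++ x < x ++ u := by
    have := h u.length hu0 (by simp; omega)
    rwa [List.drop_left, List.take_left] at this
  have h₂ : u ++ x < (u ++ x).drop x.length ++ (u ++ x).take x.length :=
    h x.length hx0 (by simp; omega)
  have hsplit := List.take_append_drop x.length (u ++ x)
  have hlen : ((u ++ x).take x.length).length = x.length := by simp
  have hylen : ((u ++ x).drop x.length).length = u.length := by simp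
  generalize (u ++ x).take x.length = z at *
  generalize (u ++ x).drop x.length = y at *
  have hzx : z = x := by
    apply le_antisymm
    · rw [← hsplit] at h₁
      exact le_of_append_lt_append hlen h₁
    · rw [← hsplit, List.append_assoc] at hv
      exact le_of_append_lt_append hlen.symm hv
  subst hzx
  have hyu : y < u := by rwa [← hsplit, append_lt_append_left_iff] at h₁
  exact absurd (le_of_append_lt_append hylen.symm h₂) (not_le.2 hyu)

theorem length_sub {β : Type*} (S : ℕ → β) (i j : ℕ) : (sub S i j).length = j + 1 - i := by
  simp [sub]

theorem sub_append_sub {β : Type*} (S : ℕ → β) {i j n : ℕ} (hij : i ≤ j + 1) (hjn : j ≤ n) :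
    sub S i j ++ sub S (j + 1) n = sub S i n := by
  have h := List.range'_append_1 (s := i) (m := j + 1 - i) (n := n + 1 - (j + 1))
  rw [show i + (j + 1 - i) = j + 1 by omega,
    show j + 1 - i + (n + 1 - (j + 1)) = n + 1 - i by omega] at h
  simp only [sub, ← List.map_append, h]

theorem drop_sub {β : Type*} (S : ℕ → β) (i j k : ℕ) : (sub S i j).drop k = sub S (i + k) j := by
  simp only [sub, ← List.map_drop, List.drop_range']
  congr 2 <;> omega

theorem nss_spec (S : ℕ → α) {n i : ℕ} (hin : i ≤ n) :
    i < nss S n i ∧ nss S n i ≤ n + 1 ∧ suf S n (nss S n i) < suf S n i ∧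
      ∀ j, i < j → j < nss S n i → suf S n i < suf S n j := by
  have hne : {j | j = n + 1 ∨ (i < j ∧ j ≤ n ∧ slt (suf S n j) (suf S n i))}.Nonempty :=
    ⟨n + 1, Or.inl rfl⟩
  have hle : nss S n i ≤ n + 1 := Nat.sInf_le (Or.inl rfl)
  have hnil : suf S n (n + 1) < suf S n i := by
    have h₀ : suf S n (n + 1) = [] := by simp [suf, sub]
    have h₁ : suf S n i ≠ [] := by
      rw [← List.length_pos_iff, suf, length_sub]; omega
    obtain ⟨x, l, h⟩ := List.exists_cons_of_ne_nil h₁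
    rw [h₀, h]
    exact List.nil_lt_cons x l
  have hmin : ∀ j, i < j → j < nss S n i → suf S n i < suf S n j := by
    intro j hij hj
    have hnot := Nat.notMem_of_lt_sInf hj
    refine lt_of_le_of_ne (not_lt.1 fun h => hnot (Or.inr ⟨hij, by omega, h⟩)) fun h => ?_
    have := congrArg List.length h
    simp only [suf, length_sub] at this
    omega
  rcases Nat.sInf_mem hne with h | ⟨h₁, -, h₂⟩
  · change nss S n i = n + 1 at h
    exact ⟨by omega, hle, h ▸ hnil, hmin⟩
  · exact ⟨h₁, hle, h₂, hmin⟩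

/-- For every `i ∈ [1,n]`, the longest Lyndon word starting at `i` is exactly
`S[i..nss(i))`; equivalently `λ[i] = nss(i) - i`. -/
theorem stmt_1 (S : ℕ → α) (n : ℕ) :
    ∀ i, 1 ≤ i → i ≤ n →
      IsLyndon (sub S i (nss S n i - 1)) ∧ lyn S n i = nss S n i - i := by
  intro i _ hin
  obtain ⟨hi, hn, hlt, hmin⟩ := nss_spec S hin
  generalize nss S n i = m at *
  obtain ⟨j, rfl⟩ : ∃ j, m = j + 1 := ⟨m - 1, by omega⟩
  rw [Nat.add_sub_cancel]
  have hlyn : IsLyndon (sub S i j) := by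
    have hne : sub S i j ≠ [] := by
      rw [← List.length_pos_iff, length_sub]; omega
    refine isLyndon_of_lt_suffixes (v := sub S (j + 1) n) hne (fun k hk hkl => ?_) ?_
    · rw [length_sub] at hkl
      rw [drop_sub, sub_append_sub S (by omega) (by omega),
        sub_append_sub S (by omega) (by omega)]
      exact hmin (i + k) (by omega) (by omega)
    · rw [sub_append_sub S (by omega) (by omega)]
      exact hlt
  refine ⟨hlyn, IsGreatest.csSup_eq ⟨⟨j, by omega, by omega, hlyn, by omega⟩, ?_⟩⟩
  rintro _ ⟨q, hiq, hqn, hq, rfl⟩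
  by_contra! hjq
  rw [← sub_append_sub S (j := j) (by omega) (by omega)] at hq
  refine not_isLyndon_append (v := sub S (q + 1) n) hlyn.1 ?_ ?_ hq
  · rw [← List.length_pos_iff, length_sub]; omega
  · rw [sub_append_sub S (by omega) (by omega), sub_append_sub S (by omega) (by omega),
      sub_append_sub S (by omega) (by omega)]
    exact hlt
end

section
/- Let S be a string of length n, let i ∈ [1,n] and let i' ∈ [i, nss(i)). Then nss(i') ≤ nss(i). -/
open List

variable {α : Type*} [LinearOrder α]

/-- For `i ∈ [1,n]` and `i' ∈ [i, nss(i))`, it holds `nss(i') ≤ nss(i)`. -/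
theorem stmt_2 (S : ℕ → α) (n i i' : ℕ)
    (hi1 : 1 ≤ i) (hi2 : i ≤ n) (h1 : i ≤ i') (h2 : i' < nss S n i) :
    nss S n i' ≤ nss S n i := by
  have hmem : nss S n i ∈
      {j | j = n + 1 ∨ (i < j ∧ j ≤ n ∧ slt (suf S n j) (suf S n i))} :=
    Nat.sInf_mem ⟨n + 1, Or.inl rfl⟩
  rcases hmem with hj | ⟨_, hjn, hlt⟩
  · exact Nat.sInf_le (Or.inl hj)
  · rcases h1.eq_or_lt with rfl | hii'
    · exact le_rfl
    · refine Nat.sInf_le (Or.inr ⟨h2, hjn, ?_⟩)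
      have hnot : ¬ slt (suf S n i') (suf S n i) := fun h =>
        Nat.notMem_of_lt_sInf h2 (Or.inr ⟨hii', h2.le.trans hjn, h⟩)
      have hle : suf S n i ≤ suf S n i' := not_lt.mp hnot
      exact lt_of_lt_of_le (show suf S n (nss S n i) < suf S n i from hlt) hle
end

section
/- Let (i,j,p) be a run in a string S of length n. Then there exists at least one index i0 ∈ [i, i+p) such that the length-p substring S[i0..i0+p) is a Lyndon word. -/
open List

variable {α : Type*} [LinearOrder α]

/-- The length-`p` window at position `k` of a sequence. -/
def window (T : ℕ → α) (p k : ℕ) : List α := (List.range p).map fun t => T (k + t)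

theorem window_congr_mod {β : Type*} {T : ℕ → β} {p a b : ℕ} (hT : ∀ x y, x ≡ y [MOD p] → T x = T y)
    (hab : a ≡ b [MOD p]) : window T p a = window T p b :=
  List.map_congr_left fun t _ => hT _ _ (hab.add_right t)

theorem drop_append_take_window {β : Type*} {T : ℕ → β} {p k d : ℕ}
    (hT : ∀ x y, x ≡ y [MOD p] → T x = T y) (hd : d ≤ p) :
    (window T p k).drop d ++ (window T p k).take d = window T p (k + d) := by
  apply List.ext_getElem
  · simp [window]; omega
  · intro m h₁ h₂
    have hm : m < p := by simpa [window] using h₂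
    rw [List.getElem_append]
    split_ifs with h
    · simp [window, add_assoc]
    · have hm' : p - d ≤ m := by simpa [window] using h
      simp only [window, List.getElem_take, List.getElem_map, List.getElem_range,
        List.length_drop, List.length_map, List.length_range]
      apply hT
      have : k + d + m = k + (m - (p - d)) + p := by omega
      rw [this]
      simp [Nat.ModEq]

/-- A periodic sequence without smaller period has a Lyndon window starting in the first period. -/
theorem exists_isLyndon_window {T : ℕ → α} {p : ℕ} (hp : 0 < p)
    (hT : ∀ x y, x ≡ y [MOD p] → T x = T y)
    (hmin : ∀ d, 0 < d → d < p → ¬ ∀ x, T x = T (x + d)) :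
    ∃ k < p, IsLyndon (window T p k) := by
  obtain ⟨k, hk, hle⟩ := Finset.exists_min_image (Finset.range p) (window T p) ⟨0, by simpa⟩
  rw [Finset.mem_range] at hk
  refine ⟨k, hk, by simp [window, hp.ne'], fun d hd hdp => ?_⟩
  replace hdp : d < p := by simpa [window] using hdp
  rw [drop_append_take_window hT hdp.le]
  have hle' : window T p k ≤ window T p (k + d) := by
    rw [← window_congr_mod hT (Nat.mod_modEq (k + d) p)]
    exact hle _ (Finset.mem_range.2 (Nat.mod_lt _ hp))
  refine lt_of_le_of_ne hle' fun heq => hmin d hd hdp fun x => ?_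
  have ht : k + (x + p - k) % p ≡ x [MOD p] := by
    have h₁ : k + (x + p - k) % p ≡ k + (x + p - k) [MOD p] :=
      (Nat.mod_modEq _ p).add_left k
    rw [show k + (x + p - k) = x + p by omega] at h₁
    exact h₁.trans (by simp [Nat.ModEq])
  have hval := List.map_inj_left.1 heq _ (List.mem_range.2 (Nat.mod_lt (x + p - k) hp))
  rw [add_right_comm, hT _ _ ht, hT _ _ (ht.add_right d)] at hval
  exact hval

theorem IsPeriod.apply_add_mod {β : Type*} {S : ℕ → β} {i j p : ℕ}
    (h : IsPeriod S i j p) (x : ℕ)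
    (hx : i + x ≤ j) : S (i + x % p) = S (i + x) := by
  have hp := h.1
  induction x using Nat.strong_induction_on with
  | _ x ih =>
    rcases lt_or_ge x p with hlt | hge
    · rw [Nat.mod_eq_of_lt hlt]
    · rw [Nat.mod_eq_sub_mod hge, ih (x - p) (by omega) (by omega),
        h.2 (i + (x - p)) (by omega) (by omega)]
      congr 1
      omega

/-- For a run `(i,j,p)` there is at least one index `i0 ∈ [i, i+p)` such that
the length-`p` substring `S[i0..i0+p)` is a Lyndon word. -/
theorem stmt_5 (S : ℕ → α) (n i j p : ℕ) (h : IsRun S n i j p) :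
    ∃ i0, i ≤ i0 ∧ i0 < i + p ∧ IsLyndon (sub S i0 (i0 + p - 1)) := by
  obtain ⟨-, hij, -, hper, hmin, hlen, -, -⟩ := h
  have hp := hper.1
  obtain ⟨k, hk, hL⟩ := exists_isLyndon_window (T := fun x => S (i + x % p)) hp
    (fun x y hxy => congrArg (fun r => S (i + r)) hxy) (fun d hd hdp hT => by
      refine hmin d hd hdp ⟨hd, fun x hix hxj => ?_⟩
      obtain ⟨y, rfl⟩ := Nat.exists_eq_add_of_le hix
      have := hT y
      rwa [hper.apply_add_mod y (by omega), hper.apply_add_mod (y + d) (by omega),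
        ← add_assoc] at this)
  refine ⟨i + k, by omega, by omega, ?_⟩
  convert hL using 1
  rw [sub, window, show i + k + p - 1 + 1 - (i + k) = p by omega, List.range'_eq_map_range,
    List.map_map]
  refine List.map_congr_left fun t ht => ?_
  rw [List.mem_range] at ht
  rw [hper.apply_add_mod (k + t) (by omega), Function.comp_apply, add_assoc]
end

section
/- Let S be a string of length n, let i ∈ [1,n] and j = nss(i) with j ≠ n+1. If rlce(i,j) ≥ j − i, then rlce(j, j + (j − i)) = rlce(i,j) − (j − i) and nss(j) = j + (j − i). -/
open List

variable {α : Type*} [LinearOrder α]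

theorem le_lcpLen_iff (a b : List α) (k : ℕ) :
    k ≤ lcpLen a b ↔ k ≤ min a.length b.length ∧ a.take k = b.take k := by
  constructor
  · intro h
    refine ⟨h.trans (Nat.findGreatest_le _), ?_⟩
    have hs : a.take (lcpLen a b) = b.take (lcpLen a b) :=
      Nat.findGreatest_spec (P := fun k => a.take k = b.take k) (Nat.zero_le _) (by simp)
    have := congrArg (List.take k) hs
    rwa [List.take_take, List.take_take, min_eq_left h] at this
  · rintro ⟨h₁, h₂⟩
    exact Nat.le_findGreatest h₁ h₂

theorem lcpLen_append_left (u a b : List α) :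
    lcpLen (u ++ a) (u ++ b) = u.length + lcpLen a b := by
  refine eq_of_forall_le_iff fun k => ?_
  rw [← tsub_le_iff_left, le_lcpLen_iff, le_lcpLen_iff, List.take_append, List.take_append,
    List.append_cancel_left_eq, List.length_append, List.length_append]
  exact and_congr_left' (by omega)

theorem slt_append_iff {u v : List α} (h : u.length = v.length) (a b : List α) :
    slt (u ++ a) (v ++ b) ↔ slt u v ∨ u = v ∧ slt a b := by
  induction u generalizing v with
  | nil =>
    obtain rfl : v = [] := List.length_eq_zero_iff.mp h.symm
    simp [slt]
  | cons x u ih =>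
    cases v with
    | nil => simp at h
    | cons y v =>
      have ih := ih (v := v) (by simpa using h)
      simp only [slt, List.cons_append, List.cons_lex_cons_iff,
        List.cons.injEq] at ih ⊢
      rw [ih]
      tauto

theorem slt_asymm {a b : List α} (h : slt a b) : ¬ slt b a :=
  lt_asymm (a := a) (b := b) h

theorem slt_of_slt_of_not_slt {a b c : List α} (h : slt a b) (h' : ¬ slt c b) : slt a c :=
  lt_of_lt_of_le (a := a) (b := b) (c := c) h (not_lt.mp h')

theorem length_suf {β : Type*} (S : ℕ → β) (n i : ℕ) : (suf S n i).length = n + 1 - i := by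
  simp [suf, sub]

theorem drop_suf {β : Type*} (S : ℕ → β) (n i k : ℕ) : (suf S n i).drop k = suf S n (i + k) := by
  simp [suf, sub, ← List.map_drop, List.drop_range', Nat.sub_sub]

theorem take_append_suf {β : Type*} (S : ℕ → β) (n i k : ℕ) :
    (suf S n i).take k ++ suf S n (i + k) = suf S n i := by
  rw [← drop_suf, List.take_append_drop]

theorem nss_mem (S : ℕ → α) (n i : ℕ) :
    nss S n i = n + 1 ∨ (i < nss S n i ∧ nss S n i ≤ n ∧ slt (suf S n (nss S n i)) (suf S n i)) :=
  Nat.sInf_mem (s := {j | j = n + 1 ∨ (i < j ∧ j ≤ n ∧ slt (suf S n j) (suf S n i))})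
    ⟨n + 1, Or.inl rfl⟩

theorem not_slt_of_lt_nss {S : ℕ → α} {n i k : ℕ} (hik : i < k) (hkn : k ≤ n)
    (hk : k < nss S n i) : ¬ slt (suf S n k) (suf S n i) :=
  fun h => Nat.notMem_of_lt_sInf hk (Or.inr ⟨hik, hkn, h⟩)

/-- If `j = nss(i) ≠ n+1` and `rlce(i,j) ≥ j - i`, then
`rlce(j, j + (j-i)) = rlce(i,j) - (j-i)` and `nss(j) = j + (j-i)`. -/
theorem stmt_6 (S : ℕ → α) (n i j : ℕ)
    (hi1 : 1 ≤ i) (hi2 : i ≤ n) (hj : j = nss S n i) (hj' : j ≠ n + 1)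
    (h : j - i ≤ rlce S n i j) :
    rlce S n j (j + (j - i)) = rlce S n i j - (j - i) ∧ nss S n j = j + (j - i) := by
  obtain ⟨hij, hjn, hlt⟩ : i < j ∧ j ≤ n ∧ slt (suf S n j) (suf S n i) := by
    subst hj
    exact (nss_mem S n i).resolve_left hj'
  obtain ⟨p, rfl⟩ := Nat.exists_eq_add_of_lt hij
  have hp : i + p + 1 - i = p + 1 := by omega
  rw [hp] at h ⊢
  rw [add_assoc i p 1] at *
  generalize p + 1 = q at *
  obtain ⟨hlen, htake⟩ := (le_lcpLen_iff _ _ _).mp h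
  rw [length_suf, length_suf] at hlen
  have hi := take_append_suf S n i q
  have hj₂ := take_append_suf S n (i + q) q
  rw [← htake] at hj₂
  have hlen_take : ((suf S n i).take q).length = q := by
    rw [List.length_take, length_suf]
    omega
  have hlt' : slt (suf S n (i + q + q)) (suf S n (i + q)) := by
    have hlt := hlt
    rw [← hi] at hlt
    nth_rw 1 [← hj₂] at hlt
    exact ((slt_append_iff rfl _ _).mp hlt).elim (fun h => absurd h (slt_asymm h)) (·.2)
  refine ⟨?_, le_antisymm (Nat.sInf_le ?_) ?_⟩
  · have hrlce := lcpLen_append_left ((suf S n i).take q) (suf S n (i + q)) (suf S n (i + q + q))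
    rw [hi, hj₂, hlen_take] at hrlce
    unfold rlce
    omega
  · by_cases hn : i + q + q = n + 1
    · exact Or.inl hn
    · exact Or.inr ⟨by omega, by omega, hlt'⟩
  · by_contra! hk
    obtain hn | ⟨hjk, hkn, hks⟩ := nss_mem S n (i + q)
    · omega
    generalize nss S n (i + q) = k at *
    obtain ⟨d, rfl⟩ := Nat.exists_eq_add_of_lt hjk
    obtain ⟨m, hm⟩ : ∃ m, q = d + 1 + m := ⟨q - (d + 1), by omega⟩
    -- `S_{i+d+1}` and `S_{i+q+d+1}` share their first `m` letters, as do `S_i` and `S_{i+q}`.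
    have hshift : (suf S n (i + (d + 1))).take m = (suf S n (i + q + (d + 1))).take m := by
      have := congrArg (List.drop (d + 1)) htake
      rwa [List.drop_take, List.drop_take, drop_suf, drop_suf,
        show q - (d + 1) = m by omega] at this
    have hpref : (suf S n i).take m = (suf S n (i + q)).take m := by
      have := congrArg (List.take m) htake
      rwa [List.take_take, List.take_take, min_eq_left (by omega)] at this
    have hlm : ((suf S n (i + q + (d + 1))).take m).length = ((suf S n (i + q)).take m).length := by
      simp only [List.length_take, length_suf]
      omega
    have hge := not_slt_of_lt_nss (S := S) (n := n) (i := i) (k := i + (d + 1))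
      (by omega) (by omega) (by omega)
    rw [← take_append_suf S n (i + (d + 1)) m, ← take_append_suf S n i m, hshift, hpref,
      slt_append_iff hlm, not_or, not_and] at hge
    rw [add_assoc (i + q) d 1, ← take_append_suf S n (i + q + (d + 1)) m,
      ← take_append_suf S n (i + q) m, slt_append_iff hlm] at hks
    obtain hks | ⟨heq, -⟩ := hks
    · exact hge.1 hks
    · refine hge.2 heq ?_
      rw [show i + (d + 1) + m = i + q by omega]
      exact slt_of_slt_of_not_slt hlt
        (not_slt_of_lt_nss (by omega) (by omega) (by omega))
end

section
/- Let S be a string of length n, let i ∈ [1,n] and j = nss(i) with j ≠ n+1. If llce(i,j) > j − i, then llce(i − (j − i), i) = llce(i,j) − (j − i) and nss(i − (j − i)) = i. -/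
open List

variable {α : Type*} [LinearOrder α]

theorem pre_reverse_length {β : Type*} (S : ℕ → β) (i : ℕ) : (pre S i).reverse.length = i := by
  simp [pre, sub]

theorem pre_reverse_getElem {β : Type*} (S : ℕ → β) (i t : ℕ)
    (h : t < (pre S i).reverse.length) :
    (pre S i).reverse[t] = S (i - t) := by
  have hi := pre_reverse_length S i
  rw [List.getElem_reverse]
  simp only [pre, sub, List.getElem_map, List.getElem_range', List.length_map,
    List.length_range']
  congr 1
  omega

theorem pre_reverse_take_eq_iff {β : Type*} (S : ℕ → β) {i j k : ℕ} (hi : k ≤ i) (hj : k ≤ j) :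
    (pre S i).reverse.take k = (pre S j).reverse.take k ↔ ∀ t < k, S (i - t) = S (j - t) := by
  have li := pre_reverse_length S i
  have lj := pre_reverse_length S j
  constructor
  · intro h t ht
    rw [← pre_reverse_getElem S i t (by omega), ← pre_reverse_getElem S j t (by omega)]
    have := congrArg (fun l => l[t]?) h
    simp only [List.getElem?_take_of_lt ht] at this
    rwa [List.getElem?_eq_getElem (by omega), List.getElem?_eq_getElem (by omega),
      Option.some_inj] at this
  · intro h
    apply List.ext_getElem
    · simp only [List.length_take, li, lj]
      omega
    · intro t h1 h2
      simp only [List.getElem_take, pre_reverse_getElem]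
      rw [List.length_take] at h1
      exact h t (by omega)

theorem llce_le (S : ℕ → α) (i j : ℕ) : llce S i j ≤ min i j := by
  have h : llce S i j ≤ min (pre S i).reverse.length (pre S j).reverse.length :=
    Nat.findGreatest_le _
  rwa [pre_reverse_length, pre_reverse_length] at h

theorem eq_of_lt_llce (S : ℕ → α) {i j t : ℕ} (ht : t < llce S i j) :
    S (i - t) = S (j - t) := by
  have hle := llce_le S i j
  refine (pre_reverse_take_eq_iff S (by omega) (by omega)).1 ?_ t ht
  exact Nat.findGreatest_spec
    (P := fun k => (pre S i).reverse.take k = (pre S j).reverse.take k) (Nat.zero_le _) (by simp)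

theorem le_llce (S : ℕ → α) {i j k : ℕ} (hi : k ≤ i) (hj : k ≤ j)
    (h : ∀ t < k, S (i - t) = S (j - t)) : k ≤ llce S i j := by
  refine Nat.le_findGreatest ?_ ((pre_reverse_take_eq_iff S hi hj).2 h)
  rw [pre_reverse_length, pre_reverse_length]
  omega

theorem suf_eq_cons {β : Type*} (S : ℕ → β) {n i : ℕ} (hi : i ≤ n) :
    suf S n i = S i :: suf S n (i + 1) := by
  have : n + 1 - i = (n + 1 - (i + 1)) + 1 := by omega
  rw [suf, suf, sub, sub, this, List.range'_succ, List.map_cons]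

theorem suf_lt_suf_iff_of_eq (S : ℕ → α) {n a b : ℕ} (m : ℕ)
    (ha : a + m ≤ n + 1) (hb : b + m ≤ n + 1) (h : ∀ t < m, S (a + t) = S (b + t)) :
    suf S n a < suf S n b ↔ suf S n (a + m) < suf S n (b + m) := by
  induction m with
  | zero => rfl
  | succ m ih =>
    rw [ih (by omega) (by omega) (fun t ht => h t (by omega)),
      suf_eq_cons S (show a + m ≤ n by omega), suf_eq_cons S (show b + m ≤ n by omega),
      List.cons_lt_cons_iff, h m (by omega)]
    simp [Nat.add_assoc]

theorem suf_lt_suf_iff_of_ne (S : ℕ → α) {n a b : ℕ} (m : ℕ)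
    (ha : a + m ≤ n) (hb : b + m ≤ n) (h : ∀ t < m, S (a + t) = S (b + t))
    (hne : S (a + m) ≠ S (b + m)) :
    suf S n a < suf S n b ↔ S (a + m) < S (b + m) := by
  rw [suf_lt_suf_iff_of_eq S m (by omega) (by omega) h, suf_eq_cons S ha, suf_eq_cons S hb,
    List.cons_lt_cons_iff]
  simp [hne]

theorem nss_eq_iff (S : ℕ → α) {n i j : ℕ} (hj : j ≠ n + 1) :
    nss S n i = j ↔ i < j ∧ j ≤ n ∧ suf S n j < suf S n i ∧
      ∀ m, i < m → m < j → ¬ suf S n m < suf S n i := by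
  constructor
  · rintro rfl
    have hmem : nss S n i ∈ {j | j = n + 1 ∨ (i < j ∧ j ≤ n ∧ slt (suf S n j) (suf S n i))} :=
      Nat.sInf_mem ⟨n + 1, Or.inl rfl⟩
    obtain h | ⟨h1, h2, h3⟩ := hmem
    · exact absurd h hj
    · refine ⟨h1, h2, h3, fun m hm hmj hlt => ?_⟩
      exact Nat.notMem_of_lt_sInf hmj (Or.inr ⟨hm, by omega, hlt⟩)
  · rintro ⟨h1, h2, h3, h4⟩
    refine le_antisymm (Nat.sInf_le (Or.inr ⟨h1, h2, h3⟩)) ?_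
    refine le_csInf ⟨n + 1, Or.inl rfl⟩ ?_
    rintro m (rfl | ⟨hm1, -, hm3⟩)
    · omega
    · by_contra hlt
      exact h4 m hm1 (by omega) hm3

theorem llce_sub_period (S : ℕ → α) {i p : ℕ} (h : p < llce S i (i + p)) :
    llce S (i - p) i = llce S i (i + p) - p := by
  have hle := llce_le S i (i + p)
  have hle' := llce_le S (i - p) i
  apply le_antisymm
  · suffices llce S (i - p) i + p ≤ llce S i (i + p) by omega
    refine le_llce S (by omega) (by omega) fun t ht => ?_
    by_cases htp : t < p
    · exact eq_of_lt_llce S (by omega)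
    · have := eq_of_lt_llce S (show t - p < llce S (i - p) i by omega)
      rwa [show i - p - (t - p) = i - t by omega, show i - (t - p) = i + p - t by omega] at this
  · refine le_llce S (by omega) (by omega) fun t ht => ?_
    have := eq_of_lt_llce S (show t + p < llce S i (i + p) by omega)
    rwa [show i - (t + p) = i - p - t by omega, show i + p - (t + p) = i - t by omega] at this

theorem nss_eq_add_of_square (S : ℕ → α) {n k p : ℕ} (hn : k + p ≤ n)
    (hj : k + p + p ≠ n + 1) (h : nss S n (k + p) = k + p + p)
    (heq : ∀ x, k ≤ x → x < k + p → S x = S (x + p)) :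
    nss S n k = k + p := by
  obtain ⟨h1, h2, h3, h4⟩ := (nss_eq_iff S hj).1 h
  refine (nss_eq_iff S (by omega)).2 ⟨by omega, hn, ?_, fun m hm hmi hlt => ?_⟩
  · refine (suf_lt_suf_iff_of_eq S p (by omega) (by omega) fun t ht => ?_).2 h3
    rw [heq (k + t) (by omega) (by omega)]
    congr 1
    omega
  · have key : ∀ t, m + t < k + p →
        S (m + p + t) = S (m + t) ∧ S (k + p + t) = S (k + t) := fun t ht => by
      rw [heq (m + t) (by omega) ht, heq (k + t) (by omega) (by omega)]
      constructor <;> congr 1 <;> omega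
    by_cases hall : ∀ t, m + t < k + p → S (m + t) = S (k + t)
    · obtain ⟨d, hd⟩ : ∃ d, m + d = k + p := ⟨k + p - m, by omega⟩
      have hshift := (suf_lt_suf_iff_of_eq S (n := n) (a := m + p) (b := k + p) d
        (by omega) (by omega) fun t ht => by
          rw [(key t (by omega)).1, (key t (by omega)).2, hall t (by omega)])
      have hnot := h4 (m + p) (by omega) (by omega)
      rw [hshift, show m + p + d = k + p + p by omega] at hnot
      exact h4 (k + p + d) (by omega) (by omega) ((not_lt.1 hnot).trans_lt h3)
    · push Not at hall
      classical
      have hspec := Nat.find_spec hall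
      have hmin : ∀ t < Nat.find hall, S (m + t) = S (k + t) := fun t ht => by
        by_contra hne
        exact Nat.find_min hall ht ⟨by omega, hne⟩
      generalize Nat.find hall = t₀ at hspec hmin
      obtain ⟨ht₀, hne⟩ := hspec
      rw [suf_lt_suf_iff_of_ne S t₀ (by omega) (by omega) hmin hne] at hlt
      refine h4 (m + p) (by omega) (by omega) ?_
      refine (suf_lt_suf_iff_of_ne S t₀ (by omega) (by omega) (fun t ht => ?_) ?_).2 ?_
      · rw [(key t (by omega)).1, (key t (by omega)).2, hmin t ht]
      · rwa [(key t₀ ht₀).1, (key t₀ ht₀).2]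
      · rwa [(key t₀ ht₀).1, (key t₀ ht₀).2]

/-- If `j = nss(i) ≠ n+1` and `llce(i,j) > j - i`, then
`llce(i - (j-i), i) = llce(i,j) - (j-i)` and `nss(i - (j-i)) = i`. -/
theorem stmt_7 (S : ℕ → α) (n i j : ℕ)
    (hi1 : 1 ≤ i) (hi2 : i ≤ n) (hj : j = nss S n i) (hj' : j ≠ n + 1)
    (h : j - i < llce S i j) :
    llce S (i - (j - i)) i = llce S i j - (j - i) ∧ nss S n (i - (j - i)) = i := by
  have hij := ((nss_eq_iff S hj').1 hj.symm).1
  obtain ⟨p, rfl⟩ := Nat.exists_eq_add_of_le hij.le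
  rw [Nat.add_sub_cancel_left] at h ⊢
  refine ⟨llce_sub_period S h, ?_⟩
  have hle := llce_le S i (i + p)
  obtain ⟨k, rfl⟩ : ∃ k, i = k + p := ⟨i - p, by omega⟩
  rw [Nat.add_sub_cancel]
  refine nss_eq_add_of_square S hi2 hj' hj.symm fun x hx hx' => ?_
  have := eq_of_lt_llce S (show k + p - x < llce S (k + p) (k + p + p) by omega)
  rwa [show k + p - (k + p - x) = x by omega,
    show k + p + p - (k + p - x) = x + p by omega] at this
end

section
/- Let S be a string of length n, let nss(i) = j and nss(i') = j' with j' ≤ n, let d = j' − i' and ℓ' = llce(i', j'), and assume i' − d ≤ i < i', j ≤ i', and ℓ' > i' − i. If (i + d) − llce(i + d, j + d) > j' − ℓ', then llce(i,j) = llce(i + d, j + d). -/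
open List

variable {α : Type*} [LinearOrder α]

theorem length_pre_reverse (S : ℕ → α) (i : ℕ) : (pre S i).reverse.length = i := by
  simp [pre, sub]

theorem getElem_pre_reverse (S : ℕ → α) (i k : ℕ) (h : k < (pre S i).reverse.length) :
    (pre S i).reverse[k] = S (i - k) := by
  rw [length_pre_reverse] at h
  simp only [pre, sub, List.getElem_reverse, List.getElem_map, List.getElem_range',
    List.length_map, List.length_range']
  congr 1
  omega

theorem take_pre_reverse_eq_iff (S : ℕ → α) {i j k : ℕ} (hi : k ≤ i) (hj : k ≤ j) :
    (pre S i).reverse.take k = (pre S j).reverse.take k ↔ ∀ m < k, S (i - m) = S (j - m) := by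
  constructor
  · intro h m hm
    have h₁ : m < (pre S i).reverse.length := by rw [length_pre_reverse]; omega
    have h₂ : m < (pre S j).reverse.length := by rw [length_pre_reverse]; omega
    have key := congrArg (fun l => l[m]?) h
    simp only [List.getElem?_take_of_lt hm, List.getElem?_eq_getElem h₁,
      List.getElem?_eq_getElem h₂, getElem_pre_reverse, Option.some.injEq] at key
    exact key
  · intro h
    apply List.ext_getElem
    · simp only [List.length_take, length_pre_reverse]
      omega
    · intro m h₁ _
      rw [List.length_take] at h₁
      rw [List.getElem_take, List.getElem_take, getElem_pre_reverse, getElem_pre_reverse]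
      exact h m (by omega)

theorem le_llce_iff (S : ℕ → α) {i j k : ℕ} :
    k ≤ llce S i j ↔ k ≤ i ∧ k ≤ j ∧ ∀ m < k, S (i - m) = S (j - m) := by
  simp only [llce, lcpLen, length_pre_reverse]
  constructor
  · intro h
    have hle := Nat.findGreatest_le
      (P := fun k => (pre S i).reverse.take k = (pre S j).reverse.take k) (min i j)
    have hspec := Nat.findGreatest_spec
      (P := fun k => (pre S i).reverse.take k = (pre S j).reverse.take k)
      (Nat.zero_le (min i j)) (by simp)
    rw [take_pre_reverse_eq_iff S (by omega) (by omega)] at hspec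
    exact ⟨by omega, by omega, fun m hm => hspec m (by omega)⟩
  · rintro ⟨hi, hj, h⟩
    exact Nat.le_findGreatest (le_min hi hj) ((take_pre_reverse_eq_iff S hi hj).2 h)

theorem nss_eq_or_lt (S : ℕ → α) (n i : ℕ) : nss S n i = n + 1 ∨ i < nss S n i := by
  have hmem : nss S n i ∈ {j | j = n + 1 ∨ (i < j ∧ j ≤ n ∧ slt (suf S n j) (suf S n i))} :=
    Nat.sInf_mem ⟨n + 1, Or.inl rfl⟩
  exact hmem.imp_right And.left

/-- Case L1: With `nss(i) = j`, `nss(i') = j' ≤ n`, `d = j' - i'`,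
`ℓ' = llce(i',j')`, `i' - d ≤ i < i'`, `j ≤ i'`, `ℓ' > i' - i`: if
`(i + d) - llce(i + d, j + d) > j' - ℓ'` then `llce(i,j) = llce(i + d, j + d)`. -/
theorem stmt_17 (S : ℕ → α) (n i j i' j' d ℓ' : ℕ)
    (hi1 : 1 ≤ i) (hi'1 : 1 ≤ i')
    (h1 : nss S n i = j) (h2 : nss S n i' = j') (h2n : j' ≤ n)
    (hd : d = j' - i') (hl : ℓ' = llce S i' j')
    (h3 : i' - d ≤ i) (h4 : i < i') (h5 : j ≤ i')
    (h6 : i' - i < ℓ')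
    (h7 : j' - ℓ' < (i + d) - llce S (i + d) (j + d)) :
    llce S i j = llce S (i + d) (j + d) := by
  obtain ⟨hℓi, hℓj, hcopy⟩ := (le_llce_iff S).1 hl.le
  have hij' : i' < j' := by
    have := nss_eq_or_lt S n i'
    omega
  have hij : i < j := by
    have := nss_eq_or_lt S n i
    omega
  have hshift : ∀ x, i' - ℓ' < x → x ≤ i' → S (x + d) = S x := by
    intro x hx hxi
    have h := hcopy (i' - x) (by omega)
    rw [show i' - (i' - x) = x by omega, show j' - (i' - x) = x + d by omega] at h
    exact h.symm
  have hL := (le_llce_iff S).1 (le_refl (llce S (i + d) (j + d)))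
  set L := llce S (i + d) (j + d) with hLdef
  have hiff : ∀ m ≤ L, (S (i - m) = S (j - m) ↔ S (i + d - m) = S (j + d - m)) := by
    intro m hm
    rw [show i + d - m = i - m + d by omega, show j + d - m = j - m + d by omega,
      hshift (i - m) (by omega) (by omega), hshift (j - m) (by omega) (by omega)]
  apply le_antisymm
  · by_contra! hlt
    obtain ⟨-, -, h⟩ := (le_llce_iff S).1 hlt
    have hlt' : L + 1 ≤ llce S (i + d) (j + d) :=
      (le_llce_iff S).2 ⟨by omega, by omega, fun m hm => (hiff m (by omega)).1 (h m hm)⟩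
    omega
  · exact (le_llce_iff S).2
      ⟨by omega, by omega, fun m hm => (hiff m (by omega)).2 (hL.2.2 m hm)⟩
end

section
/- Let S be a string of length n, let nss(i) = j and nss(i') = j' with j' ≤ n, let d = j' − i' and ℓ' = llce(i', j'), and assume i' − d ≤ i < i', j ≤ i', and ℓ' > i' − i. If (i + d) − llce(i + d, j + d) ≤ j' − ℓ', then llce(i,j) ≥ ℓ' − (i' − i). -/
open List

variable {α : Type*} [LinearOrder α]

theorem length_pre {β : Type*} (S : ℕ → β) (i : ℕ) : (pre S i).length = i := by
  simp [pre, sub]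

theorem getElem_reverse_pre {β : Type*} (S : ℕ → β) (i t : ℕ)
    (ht : t < (pre S i).reverse.length) :
    (pre S i).reverse[t] = S (i - t) := by
  have h : t < i := by simpa [length_pre] using ht
  simp only [pre, sub, List.getElem_reverse, List.getElem_map, List.getElem_range',
    List.length_map, List.length_range']
  congr 1
  omega

theorem llce_le_left (S : ℕ → α) (i j : ℕ) : llce S i j ≤ i := by
  refine (Nat.findGreatest_le _).trans ?_
  simp [length_pre]

theorem llce_le_right (S : ℕ → α) (i j : ℕ) : llce S i j ≤ j := by
  refine (Nat.findGreatest_le _).trans ?_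
  simp [length_pre]

/-- Case L2: With `nss(i) = j`, `nss(i') = j' ≤ n`, `d = j' - i'`,
`ℓ' = llce(i',j')`, `i' - d ≤ i < i'`, `j ≤ i'`, `ℓ' > i' - i`: if
`(i + d) - llce(i + d, j + d) ≤ j' - ℓ'` then `llce(i,j) ≥ ℓ' - (i' - i)`. -/
theorem stmt_18 (S : ℕ → α) (n i j i' j' d ℓ' : ℕ)
    (hi1 : 1 ≤ i) (hi'1 : 1 ≤ i')
    (h1 : nss S n i = j) (h2 : nss S n i' = j') (h2n : j' ≤ n)
    (hd : d = j' - i') (hl : ℓ' = llce S i' j')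
    (h3 : i' - d ≤ i) (h4 : i < i') (h5 : j ≤ i')
    (h6 : i' - i < ℓ')
    (h7 : (i + d) - llce S (i + d) (j + d) ≤ j' - ℓ') :
    ℓ' - (i' - i) ≤ llce S i j := by
  have hj' := nss_eq_or_lt S n i'
  have hj := nss_eq_or_lt S n i
  rw [h2] at hj'
  rw [h1] at hj
  have hi' : ℓ' ≤ i' := hl ▸ llce_le_left S i' j'
  have hid := llce_le_left S (i + d) (j + d)
  have shift : ∀ x, i' - ℓ' < x → x ≤ i' → S x = S (x + d) := by
    intro x hx hx'
    have h := eq_of_lt_llce S (show i' - x < llce S i' j' by omega)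
    rwa [show i' - (i' - x) = x by omega, show j' - (i' - x) = x + d by omega] at h
  refine le_llce S (by omega) (by omega) fun t ht => ?_
  have h := eq_of_lt_llce S (show t < llce S (i + d) (j + d) by omega)
  rw [shift (i - t) (by omega) (by omega), shift (j - t) (by omega) (by omega)]
  rwa [show i + d - t = i - t + d by omega, show j + d - t = j - t + d by omega] at h
end
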